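/- Let M be an m×(m−2) matrix whose entries are homogeneous linear forms from R = k[x,y]. Assume that for every X ∈ GL_m(k) and every Y ∈ GL_{m−2}(k), the product matrix XMY does not contain a p×q submatrix of zeros for any pair of positive integers (p,q) with p + q = m. Then there exist matrices U ∈ GL_m(k) and V ∈ GL_{m−2}(k) and non-negative integers τ ≤ σ with σ + τ = m − 2 such that UMV is the block matrix with diagonal blocks D(σ) and D(τ). -/

import Mathlib

open MvPolynomial

/-- The `m × r` block matrix `[[D(σ),0],[0,D(τ)]]` (with `r = σ + τ`), where `D(a)` is the
`(a+1) × a` matrix with `x` on the main diagonal and `y` on the subdiagonal. -/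
noncomputable def scrollBlockMatrix (k : Type*) [CommSemiring k] (m r σ : ℕ) :
    Matrix (Fin m) (Fin r) (MvPolynomial (Fin 2) k) :=
  Matrix.of fun i j =>
    if (j : ℕ) < σ then
      (if (i : ℕ) = (j : ℕ) then X 0 else if (i : ℕ) = (j : ℕ) + 1 then X 1 else 0)
    else
      (if (i : ℕ) = (j : ℕ) + 1 then X 0 else if (i : ℕ) = (j : ℕ) + 2 then X 1 else 0)

open Module

/-- A subspace is spanned by part of a basis whose remaining coordinates vanish on it. -/
theorem exists_basis_adapted_to_submodule {k V : Type*} [Field k] [AddCommGroup V] [Module k V]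
    [FiniteDimensional k V] {n : ℕ} (hn : finrank k V = n) (W : Submodule k V) :
    ∃ (b : Basis (Fin n) k V) (e : Fin (finrank k W) ⊕ Fin (n - finrank k W) ≃ Fin n),
      (∀ i, b (e (Sum.inl i)) ∈ W) ∧ ∀ i, ∀ w ∈ W, b.repr w (e (Sum.inr i)) = 0 := by
  obtain ⟨W', hW⟩ := Submodule.exists_isCompl W
  have hdim : finrank k W' = n - finrank k W := by
    have := Submodule.finrank_add_eq_of_isCompl hW
    omega
  have hle : finrank k W ≤ n := hn ▸ Submodule.finrank_le W
  let e : Fin (finrank k W) ⊕ Fin (n - finrank k W) ≃ Fin n :=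
    finSumFinEquiv.trans (finCongr (by omega))
  let b := ((finBasis k W).prod (finBasisOfFinrankEq k W' hdim)).map
    (Submodule.prodEquivOfIsCompl W W' hW)
  refine ⟨b.reindex e, e, fun i => ?_, fun i w hw => ?_⟩
  · simp [b]
  · have : (Submodule.prodEquivOfIsCompl W W' hW).symm w = (⟨w, hw⟩, 0) :=
      Submodule.prodEquivOfIsCompl_symm_apply_left W W' hW ⟨w, hw⟩
    simp [b, this]

/-- A pair of linear maps that strictly increases the dimension of every nonzero subspace
decomposes into chains: `A` and `B` send each chain in `V` to a chain in `U` that is longer by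
one, `A` without shift and `B` with a shift by one. -/
theorem exists_chain_bases.{v, u} {k : Type v} [Field k] (n : ℕ) :
    ∀ (V U : Type u) [AddCommGroup V] [Module k V] [FiniteDimensional k V]
      [AddCommGroup U] [Module k U] [FiniteDimensional k U] (A B : V →ₗ[k] U),
      finrank k V = n →
      (∀ W : Submodule k V, W ≠ ⊥ → finrank k W < finrank k ↥(W.map A ⊔ W.map B)) →
      ∃ (ι : Type) (_ : Fintype ι) (a : ι → ℕ) (bV : Basis (Σ i, Fin (a i)) k V)
        (bU : Basis (Σ i, Fin (a i + 1)) k U),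
        ∀ i j, A (bV ⟨i, j⟩) = bU ⟨i, j.castSucc⟩ ∧ B (bV ⟨i, j⟩) = bU ⟨i, j.succ⟩ := by
  induction n using Nat.strong_induction_on with
  | _ n ih =>
  intro V U _ _ _ _ _ _ A B hn hW
  rcases Nat.eq_zero_or_pos n with rfl | hpos
  · have : Subsingleton V := finrank_zero_iff.mp hn
    have : IsEmpty (Σ _ : Fin (finrank k U), Fin 0) := ⟨fun s => s.2.elim0⟩
    refine ⟨Fin (finrank k U), inferInstance, fun _ => 0, Basis.empty V,
      (finBasis k U).reindex (Equiv.sigmaUnique _ fun _ => Fin 1).symm, fun i j => j.elim0⟩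
  let L : V × V →ₗ[k] U := B.coprod (-A)
  have hL : ∀ p, L p = B p.1 - A p.2 := fun p => by simp [L, sub_eq_add_neg]
  let K := LinearMap.ker L
  have hrange : LinearMap.range L = (⊤ : Submodule k V).map A ⊔ (⊤ : Submodule k V).map B := by
    simp [L, LinearMap.range_coprod, sup_comm]
  have hrank : finrank k ↥(LinearMap.range L) + finrank k K = n + n := by
    rw [LinearMap.finrank_range_add_finrank_ker, finrank_prod, hn]
  have htop : (⊤ : Submodule k V) ≠ ⊥ := by
    intro h
    have := congrArg (fun S : Submodule k V => finrank k S) h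
    simp [hn] at this
    omega
  have hlt : finrank k K < n := by
    have := hW ⊤ htop
    rw [← hrange, finrank_top, hn] at this
    omega
  let p₁ : K →ₗ[k] V := LinearMap.fst k V V ∘ₗ K.subtype
  let p₂ : K →ₗ[k] V := LinearMap.snd k V V ∘ₗ K.subtype
  obtain ⟨ι, _, a, bK, bV, hb⟩ := ih _ hlt K V p₁ p₂ rfl (by
    intro S hS
    set T := S.map p₁ ⊔ S.map p₂ with hT
    have hT0 : T ≠ ⊥ := by
      intro h0
      apply hS
      rw [eq_bot_iff]
      intro s hs
      have h1 : p₁ s ∈ T := Submodule.mem_sup_left (Submodule.mem_map_of_mem hs)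
      have h2 : p₂ s ∈ T := Submodule.mem_sup_right (Submodule.mem_map_of_mem hs)
      rw [h0, Submodule.mem_bot] at h1 h2
      rw [Submodule.mem_bot]
      exact Subtype.ext (Prod.ext h1 h2)
    let LT : T × T →ₗ[k] U := L ∘ₗ T.subtype.prodMap T.subtype
    have hr : LinearMap.range LT = T.map A ⊔ T.map B := by
      have : LT = (B ∘ₗ T.subtype).coprod (-(A ∘ₗ T.subtype)) := by
        ext x <;> simp [LT, L]
      rw [this, LinearMap.range_coprod, LinearMap.range_neg, LinearMap.range_comp,
        LinearMap.range_comp, Submodule.range_subtype, sup_comm]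
    have h1 := LinearMap.finrank_range_add_finrank_ker LT
    rw [hr, finrank_prod] at h1
    have h2 := hW T hT0
    let g : S →ₗ[k] LinearMap.ker LT := LinearMap.codRestrict _
      (((p₁ ∘ₗ S.subtype).codRestrict T fun s =>
        Submodule.mem_sup_left (Submodule.mem_map_of_mem s.2)).prod
      ((p₂ ∘ₗ S.subtype).codRestrict T fun s =>
        Submodule.mem_sup_right (Submodule.mem_map_of_mem s.2)))
      (fun s => s.1.2)
    have hg : Function.Injective g := by
      intro s t h
      have h' := congrArg Subtype.val h
      have e1 : (s : K).1.1 = (t : K).1.1 := congrArg (fun q : T × T => (q.1 : V)) h'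
      have e2 : (s : K).1.2 = (t : K).1.2 := congrArg (fun q : T × T => (q.2 : V)) h'
      exact Subtype.ext (Subtype.ext (Prod.ext e1 e2))
    have h3 := LinearMap.finrank_le_finrank_of_injective hg
    omega)
  obtain ⟨C, hC⟩ := Submodule.exists_isCompl (LinearMap.range L)
  have hshift : ∀ i (j : Fin (a i)), B (bV ⟨i, j.castSucc⟩) = A (bV ⟨i, j.succ⟩) := by
    intro i j
    rw [← (hb i j).1, ← (hb i j).2]
    have := (bK ⟨i, j⟩).2
    rw [LinearMap.mem_ker, hL, sub_eq_zero] at this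
    exact this
  let c := finrank k C
  let a' : ι ⊕ Fin c → ℕ := Sum.elim (fun i => a i + 1) (fun _ => 0)
  let u : (Σ i, Fin (a' i + 1)) → U := fun s => match s with
    | ⟨.inl i, j⟩ => Fin.lastCases (motive := fun _ => U) (B (bV ⟨i, Fin.last (a i)⟩))
        (fun l => A (bV ⟨i, l⟩)) j
    | ⟨.inr l, _⟩ => (finBasis k C l : U)
  have huA : ∀ i (j : Fin (a i + 1)), u ⟨.inl i, j.castSucc⟩ = A (bV ⟨i, j⟩) := fun i j =>
    Fin.lastCases_castSucc (motive := fun _ => U) ..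
  have huB : ∀ i (j : Fin (a i + 1)), u ⟨.inl i, j.succ⟩ = B (bV ⟨i, j⟩) := by
    intro i j
    induction j using Fin.lastCases with
    | last => exact Fin.lastCases_last (motive := fun _ => U) ..
    | cast j => rw [hshift, ← huA, Fin.succ_castSucc]
  have hspan : ⊤ ≤ Submodule.span k (Set.range u) := by
    rw [← hC.sup_eq_top, hrange]
    refine sup_le (sup_le ?_ ?_) ?_
    · rw [← bV.span_eq, Submodule.map_span, Submodule.span_le]
      rintro _ ⟨_, ⟨⟨i, j⟩, rfl⟩, rfl⟩
      exact Submodule.subset_span ⟨⟨.inl i, j.castSucc⟩, huA i j⟩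
    · rw [← bV.span_eq, Submodule.map_span, Submodule.span_le]
      rintro _ ⟨_, ⟨⟨i, j⟩, rfl⟩, rfl⟩
      exact Submodule.subset_span ⟨⟨.inl i, j.succ⟩, huB i j⟩
    · have : C = Submodule.map C.subtype ⊤ := by simp
      rw [this, ← (finBasis k C).span_eq, Submodule.map_span, Submodule.span_le]
      rintro _ ⟨_, ⟨l, rfl⟩, rfl⟩
      exact Submodule.subset_span ⟨⟨.inr l, 0⟩, rfl⟩
  have hcard : Fintype.card (Σ i, Fin (a' i + 1)) = finrank k U := by
    have h1 := Submodule.finrank_add_eq_of_isCompl hC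
    have h2 := finrank_eq_card_basis bK
    have h3 := finrank_eq_card_basis bV
    simp only [Fintype.card_sigma, Fintype.card_fin, Finset.sum_add_distrib] at h2 h3
    simp only [Fintype.card_sigma, Fintype.card_fin, Fintype.sum_sum_type, a', Sum.elim_inl,
      Sum.elim_inr, Finset.sum_add_distrib, Finset.sum_const, Finset.card_univ, smul_eq_mul,
      Fintype.card_sum, Fintype.card_fin] at h3 ⊢
    change finrank k K = _ at h2
    omega
  let eV : (Σ i, Fin (a i + 1)) ≃ Σ i, Fin (a' i) :=
    ((Equiv.sumSigmaDistrib fun i => Fin (a' i)).trans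
      (@Equiv.sumEmpty _ (Σ l : Fin c, Fin (a' (.inr l))) ⟨fun s => Fin.elim0 s.2⟩)).symm
  refine ⟨ι ⊕ Fin c, inferInstance, a', bV.reindex eV,
    basisOfTopLeSpanOfCardEqFinrank u hspan hcard, ?_⟩
  rintro (i | l) j
  · have : eV.symm ⟨.inl i, j⟩ = ⟨i, j⟩ := rfl
    simp only [Basis.reindex_apply, this, coe_basisOfTopLeSpanOfCardEqFinrank]
    exact ⟨(huA i j).symm, (huB i j).symm⟩
  · exact Fin.elim0 j

/-- Entries of a linear matrix after a change of bases. -/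
theorem toMatrix_mul_linear_mul_toMatrix_apply {k : Type*} [Field k] {m n : ℕ}
    (A B : Matrix (Fin m) (Fin n) k) (M : Matrix (Fin m) (Fin n) (MvPolynomial (Fin 2) k))
    (hM : M = (X 0 : MvPolynomial (Fin 2) k) • A.map C + (X 1 : MvPolynomial (Fin 2) k) • B.map C)
    (c : Basis (Fin n) k (Fin n → k)) (d : Basis (Fin m) k (Fin m → k)) (i : Fin m) (j : Fin n) :
    ((d.toMatrix (Pi.basisFun k (Fin m))).map (fun t => (C t : MvPolynomial (Fin 2) k)) * M *
      ((Pi.basisFun k (Fin n)).toMatrix c).map (fun t => (C t : MvPolynomial (Fin 2) k))) i j =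
      C (d.repr (A.toLin' (c j)) i) * X 0 + C (d.repr (B.toLin' (c j)) i) * X 1 := by
  have key : ∀ D : Matrix (Fin m) (Fin n) k, d.repr (D.toLin' (c j)) i =
      (d.toMatrix (Pi.basisFun k (Fin m)) * D * (Pi.basisFun k (Fin n)).toMatrix c) i j := by
    intro D
    have := basis_toMatrix_mul_linearMap_toMatrix_mul_basis_toMatrix c (Pi.basisFun k (Fin n))
      d (Pi.basisFun k (Fin m)) D.toLin'
    rw [← Matrix.toLin_eq_toLin', LinearMap.toMatrix_toLin, Matrix.toLin_eq_toLin'] at this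
    rw [this, LinearMap.toMatrix_apply]
  have hmap : ∀ {p q : ℕ} (D : Matrix (Fin p) (Fin q) k),
      D.map (fun t => (C t : MvPolynomial (Fin 2) k)) = D.map (C : k →+* _) := fun _ => rfl
  rw [key, key, hM, hmap, hmap, Matrix.mul_add, Matrix.add_mul, Matrix.mul_smul, Matrix.mul_smul,
    Matrix.smul_mul, Matrix.smul_mul, ← Matrix.map_mul, ← Matrix.map_mul, ← Matrix.map_mul,
    ← Matrix.map_mul, Matrix.add_apply, Matrix.smul_apply, Matrix.smul_apply, Matrix.map_apply,
    Matrix.map_apply, smul_eq_mul, smul_eq_mul, mul_comm (X 0), mul_comm (X 1)]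

theorem isHomogeneous_one_fin_two_eq {k : Type*} [CommSemiring k] {f : MvPolynomial (Fin 2) k}
    (hf : f.IsHomogeneous 1) : ∃ a b : k, f = C a * X 0 + C b * X 1 := by
  rw [← mem_homogeneousSubmodule, homogeneousSubmodule_one_eq_span_X] at hf
  obtain ⟨c, rfl⟩ := (Submodule.mem_span_range_iff_exists_fun k).mp hf
  exact ⟨c 0, c 1, by simp [Fin.sum_univ_two, smul_eq_C_mul]⟩

/-!
STATEMENT 4 (Lemma 2.7b).  `m` is written as `m' + 2`, so `M` is an `(m'+2) × m'`
matrix of linear forms in `R = k[x,y]`.  If for all invertible `X ∈ GL_{m'+2}(k)` and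
`Y ∈ GL_{m'}(k)` the matrix `XMY` contains no `p × q` submatrix of zeros with
`p, q > 0` and `p + q = m' + 2`, then `M` can be transformed by invertible row and
column operations over `k` into the block matrix `[[D(σ),0],[0,D(τ)]]` with
`τ ≤ σ` and `σ + τ = m'`.
-/

theorem linear_matrix_normal_form_of_no_zero_submatrix
    {k : Type*} [Field k] (m' : ℕ)
    (M : Matrix (Fin (m' + 2)) (Fin m') (MvPolynomial (Fin 2) k))
    (hM : ∀ i j, (M i j).IsHomogeneous 1)
    (hcond : ∀ (X : Matrix (Fin (m' + 2)) (Fin (m' + 2)) k)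
        (Y : Matrix (Fin m') (Fin m') k), IsUnit X.det → IsUnit Y.det →
      ¬ ∃ (p q : ℕ), 0 < p ∧ 0 < q ∧ p + q = m' + 2 ∧
        ∃ (r : Fin p ↪ Fin (m' + 2)) (c : Fin q ↪ Fin m'),
          ∀ a b, ((X.map (fun t => (MvPolynomial.C t : MvPolynomial (Fin 2) k))) * M *
            (Y.map (fun t => (MvPolynomial.C t : MvPolynomial (Fin 2) k)))) (r a) (c b) = 0) :
    ∃ (U : Matrix (Fin (m' + 2)) (Fin (m' + 2)) k) (V : Matrix (Fin m') (Fin m') k),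
      IsUnit U.det ∧ IsUnit V.det ∧
      ∃ σ τ : ℕ, τ ≤ σ ∧ σ + τ = m' ∧
        (U.map (fun t => (MvPolynomial.C t : MvPolynomial (Fin 2) k))) * M *
          (V.map (fun t => (MvPolynomial.C t : MvPolynomial (Fin 2) k))) =
          scrollBlockMatrix k (m' + 2) m' σ := by
  choose A₀ B₀ hAB using fun i j => isHomogeneous_one_fin_two_eq (hM i j)
  let A : Matrix (Fin (m' + 2)) (Fin m') k := A₀
  let B : Matrix (Fin (m' + 2)) (Fin m') k := B₀
  have hMAB : M = (X 0 : MvPolynomial (Fin 2) k) • A.map C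
      + (X 1 : MvPolynomial (Fin 2) k) • B.map C := by
    ext1 i j
    rw [hAB, Matrix.add_apply, Matrix.smul_apply, Matrix.smul_apply, Matrix.map_apply,
      Matrix.map_apply, smul_eq_mul, smul_eq_mul, mul_comm (X 0), mul_comm (X 1)]
  have hdet : ∀ {n : ℕ} (b c : Basis (Fin n) k (Fin n → k)), IsUnit (b.toMatrix c).det :=
    fun b c => (Matrix.isUnit_iff_isUnit_det _).mp
      (IsUnit.of_mul_eq_one _ (b.toMatrix_mul_toMatrix_flip c))
  obtain ⟨ι, _, a, bV, bU, hb⟩ := exists_chain_bases m' (Fin m' → k) (Fin (m' + 2) → k)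
    A.toLin' B.toLin' (by simp) (by
      intro W hW
      by_contra! hle
      set Z := W.map A.toLin' ⊔ W.map B.toLin' with hZ
      obtain ⟨c, e, hc, -⟩ := exists_basis_adapted_to_submodule (n := m') (by simp) W
      obtain ⟨d, f, -, hd⟩ := exists_basis_adapted_to_submodule (n := m' + 2) (by simp) Z
      have hWm : finrank k W ≤ m' := by simpa using Submodule.finrank_le W
      refine hcond _ _ (hdet d (Pi.basisFun k _)) (hdet (Pi.basisFun k _) c)
        ⟨m' + 2 - finrank k W, finrank k W, by omega,
          Nat.pos_of_ne_zero (by simpa [Submodule.finrank_eq_zero] using hW), by omega,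
          (Fin.castLEEmb (by omega)).trans (Function.Embedding.inr.trans f.toEmbedding),
          Function.Embedding.inl.trans e.toEmbedding, fun i j => ?_⟩
      rw [toMatrix_mul_linear_mul_toMatrix_apply A B M hMAB]
      simp only [Function.Embedding.trans_apply, Function.Embedding.inl_apply,
        Function.Embedding.inr_apply, Equiv.coe_toEmbedding]
      rw [hd _ _ (Submodule.mem_sup_left (Submodule.mem_map_of_mem (hc j))),
        hd _ _ (Submodule.mem_sup_right (Submodule.mem_map_of_mem (hc j)))]
      simp)
  have hV := finrank_eq_card_basis bV
  have hU := finrank_eq_card_basis bU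
  simp only [finrank_fin_fun, Fintype.card_sigma, Fintype.card_fin, Finset.sum_add_distrib,
    Finset.sum_const, Finset.card_univ, smul_eq_mul, mul_one] at hV hU
  obtain ⟨e, he⟩ : ∃ e : Fin 2 ≃ ι, a (e 1) ≤ a (e 0) := by
    have e := (Fintype.equivFinOfCardEq (show Fintype.card ι = 2 by omega)).symm
    rcases le_total (a (e 1)) (a (e 0)) with h | h
    · exact ⟨e, h⟩
    · exact ⟨(Equiv.swap 0 1).trans e, by simpa using h⟩
  have hsum : a (e 0) + a (e 1) = m' := by
    rw [hV, ← e.sum_comp, Fin.sum_univ_two]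
  let eV : (Σ i, Fin (a (e i))) ≃ Fin m' :=
    finSigmaFinEquiv.trans (finCongr (by rw [Fin.sum_univ_two, hsum]))
  let eU : (Σ i, Fin (a (e i) + 1)) ≃ Fin (m' + 2) :=
    finSigmaFinEquiv.trans (finCongr (by rw [Fin.sum_univ_two]; omega))
  let cV := (bV.reindex (e.sigmaCongrLeft (β := fun i => Fin (a i))).symm).reindex eV
  let cU := (bU.reindex (e.sigmaCongrLeft (β := fun i => Fin (a i + 1))).symm).reindex eU
  have hcA : ∀ i (j : Fin (a (e i))), A.toLin' (cV (eV ⟨i, j⟩)) = cU (eU ⟨i, j.castSucc⟩) := by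
    intro i j
    simpa [cV, cU] using (hb (e i) j).1
  have hcB : ∀ i (j : Fin (a (e i))), B.toLin' (cV (eV ⟨i, j⟩)) = cU (eU ⟨i, j.succ⟩) := by
    intro i j
    simpa [cV, cU] using (hb (e i) j).2
  refine ⟨_, _, hdet cU (Pi.basisFun k _), hdet (Pi.basisFun k _) cV, a (e 0), a (e 1), he, hsum, ?_⟩
  ext1 i j
  rw [toMatrix_mul_linear_mul_toMatrix_apply A B M hMAB]
  obtain ⟨⟨s, j⟩, rfl⟩ := eV.surjective j
  rw [hcA, hcB, Basis.repr_self, Basis.repr_self, Finsupp.single_apply, Finsupp.single_apply]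
  have hU0 : ∀ l : Fin (a (e 0) + 1), (eU ⟨0, l⟩ : ℕ) = l := by
    intro l; simp [eU, finSigmaFinEquiv_apply]
  have hU1 : ∀ l : Fin (a (e 1) + 1), (eU ⟨1, l⟩ : ℕ) = a (e 0) + 1 + l := by
    intro l; simp [eU, finSigmaFinEquiv_apply]
  have hV0 : ∀ l : Fin (a (e 0)), (eV ⟨0, l⟩ : ℕ) = l := by
    intro l; simp [eV, finSigmaFinEquiv_apply]
  have hV1 : ∀ l : Fin (a (e 1)), (eV ⟨1, l⟩ : ℕ) = a (e 0) + l := by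
    intro l; simp [eV, finSigmaFinEquiv_apply]
  simp only [scrollBlockMatrix, Matrix.of_apply, Fin.ext_iff]
  fin_cases s
  · have hj := j.2
    simp only [Fin.zero_eta, Fin.isValue, hU0, hV0, Fin.val_castSucc, Fin.val_succ]
    simp only [Fin.zero_eta, Fin.isValue] at hj
    split_ifs <;> first | omega | simp
  · simp only [Fin.mk_one, Fin.isValue, hU1, hV1, Fin.val_castSucc, Fin.val_succ]
    split_ifs <;> first | omega | simp
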